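/- Let $p$ be a prime, $P = C_p \wr C_p$ with base group $A = C_p^p$, let $\lambda$ be a non-principal irreducible character of $C_p$, and let $\nu = \lambda^{i_1} \times \cdots \times \lambda^{i_p}$ be a linear character of $A$ whose exponents $i_1, \dots, i_p$ are not all congruent modulo $p$ (so that $\nu^P$ is irreducible). Then $\nu^P$ is a faithful character of $P$ if and only if $i_1 + i_2 + \cdots + i_p \not\equiv 0 \pmod{p}$. -/

import Mathlib

/-!  Basic set-up: the regular wreath product `C_p ≀ C_p` and elementary character theory. -/

/-- The additive automorphism of `ZMod p → ZMod p` rotating the coordinates by `k`. -/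
def rotAdd (p : ℕ) (k : ZMod p) : (ZMod p → ZMod p) ≃+ (ZMod p → ZMod p) where
  toFun f := fun i => f (i + k)
  invFun f := fun i => f (i - k)
  left_inv f := funext fun i => by simp
  right_inv f := funext fun i => by simp
  map_add' f g := rfl

/-- The action of `C_p` on the base group `C_p^p` by cyclically permuting the coordinates. -/
def rotHom (p : ℕ) :
    Multiplicative (ZMod p) →* MulAut (Multiplicative (ZMod p → ZMod p)) where
  toFun k := AddEquiv.toMultiplicative (rotAdd p (Multiplicative.toAdd k))
  map_one' := MulEquiv.ext fun f =>
    congrArg Multiplicative.ofAdd (funext fun i =>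
      congrArg (Multiplicative.toAdd f) (add_zero i))
  map_mul' k l := MulEquiv.ext fun f =>
    congrArg Multiplicative.ofAdd (funext fun i =>
      congrArg (Multiplicative.toAdd f)
        (add_assoc i (Multiplicative.toAdd k) (Multiplicative.toAdd l)).symm)

/-- The regular wreath product `P = C_p ≀ C_p`: the semidirect product of the base group
`A = C_p^p` with `C_p` acting by cyclically permuting the coordinates. -/
abbrev Wr (p : ℕ) : Type :=
  Multiplicative (ZMod p → ZMod p) ⋊[rotHom p] Multiplicative (ZMod p)

noncomputable instance (p : ℕ) [NeZero p] : Fintype (Wr p) :=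
  Fintype.ofEquiv (Multiplicative (ZMod p → ZMod p) × Multiplicative (ZMod p))
    { toFun := fun x => ⟨x.1, x.2⟩
      invFun := fun g => (g.left, g.right)
      left_inv := fun _ => rfl
      right_inv := fun _ => rfl }

section CharacterTheory

variable (G : Type*) [Group G]

/-- A function `G → ℂ` is a (complex) character if it is the pointwise trace of some
finite-dimensional complex matrix representation of `G`. -/
def IsCharacter (χ : G → ℂ) : Prop :=
  ∃ (n : ℕ) (ρ : G →* Matrix.GeneralLinearGroup (Fin n) ℂ),
    ∀ g : G, χ g = Matrix.trace (ρ g : Matrix (Fin n) (Fin n) ℂ)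

variable [Fintype G]

/-- The standard inner product of class functions on a finite group. -/
noncomputable def charInner (χ ψ : G → ℂ) : ℂ :=
  (Fintype.card G : ℂ)⁻¹ * ∑ g : G, χ g * (starRingEnd ℂ) (ψ g)

/-- A character is irreducible iff it has norm one with respect to the standard
inner product of class functions. -/
def IsIrreducibleCharacter (χ : G → ℂ) : Prop :=
  IsCharacter G χ ∧ charInner G χ χ = 1

/-- A character is faithful if its kernel `{g | χ g = χ 1}` is trivial. -/
def IsFaithfulCharacter (χ : G → ℂ) : Prop :=
  ∀ g : G, χ g = χ 1 → g = 1

/-- The number of distinct irreducible constituents of a character, i.e. the number of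
irreducible characters occurring in it with nonzero multiplicity. -/
noncomputable def numConstituents (χ : G → ℂ) : ℕ :=
  Set.ncard {θ : G → ℂ | IsIrreducibleCharacter G θ ∧ charInner G χ θ ≠ 0}

end CharacterTheory

section Wreath

variable (p : ℕ) [NeZero p]

/-- The character of the wreath product `C_p ≀ C_p` induced from a character `ν` of the
base group `A = C_p^p`, given by the usual induced-character formula. -/
noncomputable def inducedFromBase (ν : Multiplicative (ZMod p → ZMod p) → ℂ) :
    Wr p → ℂ := fun g =>
  (Fintype.card (Multiplicative (ZMod p → ZMod p)) : ℂ)⁻¹ *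
    ∑ x : Wr p,
      if (x * g * x⁻¹).right = 1 then ν ((x * g * x⁻¹).left) else 0

/-- The linear character `λ^{i₁} × ⋯ × λ^{iₚ}` of the base group `A = C_p^p` attached to a
character `λ` of `C_p` and the `p`-tuple `t = (i₁, …, iₚ)` of exponents modulo `p`. -/
noncomputable def tupleChar (lam : Multiplicative (ZMod p) → ℂ) (t : ZMod p → ZMod p) :
    Multiplicative (ZMod p → ZMod p) → ℂ := fun f =>
  ∏ j : ZMod p, (lam (Multiplicative.ofAdd (Multiplicative.toAdd f j))) ^ (t j).val

/-- The embedding of `C_p` as the diagonal of the base group `C_p^p`. -/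
def constHom : Multiplicative (ZMod p) →* Multiplicative (ZMod p → ZMod p) where
  toFun x := Multiplicative.ofAdd fun _ => Multiplicative.toAdd x
  map_one' := rfl
  map_mul' _ _ := rfl

/-- The diagonal subgroup `{(x, …, x) ∣ x ∈ C_p}` of the base group, inside `C_p ≀ C_p`. -/
def diagonalSubgroup : Subgroup (Wr p) :=
  (SemidirectProduct.inl.comp (constHom p)).range

end Wreath

section Helpers

/-- The exponent-shift operator is injective when the exponents do not sum to zero. -/
lemma aux_conv (p : ℕ) [Fact p.Prime] (t f : ZMod p → ZMod p) (hs : ∑ j, t j ≠ 0)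
    (h : ∀ k, ∑ j, t j * f (j + k) = 0) : f = 0 := by
  let S : Module.End (ZMod p) (ZMod p → ZMod p) := LinearMap.funLeft (ZMod p) (ZMod p) (fun i => i + 1)
  have hS : ∀ (n : ℕ) (g : ZMod p → ZMod p) (i : ZMod p), (S ^ n) g i = g (i + n) := by
    intro n
    induction n with
    | zero => intro g i; simp
    | succ n ih =>
      intro g i
      rw [pow_succ, Module.End.mul_apply, ih]
      simp [S, LinearMap.funLeft_apply, add_assoc]
  let q : Polynomial (ZMod p) := ∑ j : ZMod p, Polynomial.C (t j) * Polynomial.X ^ (j.val)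
  have hSp : S ^ p = 1 := by
    refine LinearMap.ext fun g => funext fun i => ?_
    rw [hS]; simp
  have hq : (Polynomial.aeval S q) f = 0 := by
    ext k
    rw [Pi.zero_apply, ← h k]
    simp only [q, map_sum, map_mul, map_pow, Polynomial.aeval_C, Polynomial.aeval_X,
      LinearMap.sum_apply, Finset.sum_apply, Module.End.mul_apply, Module.algebraMap_end_apply,
      Pi.smul_apply, smul_eq_mul, hS]
    refine Finset.sum_congr rfl fun j _ => ?_
    rw [ZMod.natCast_zmod_val, add_comm]
  have hqp : (Polynomial.aeval S q) ^ p = algebraMap (ZMod p) _ (∑ j, t j) := by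
    rw [← map_pow, ← ZMod.expand_card, Polynomial.expand_aeval, hSp]
    simp [q]
  have h2 : ((Polynomial.aeval S q) ^ p) f = 0 := by
    obtain ⟨m, hm⟩ : ∃ m, p = m + 1 := ⟨p - 1, by have := (Fact.out : p.Prime).pos; omega⟩
    have : ∀ m : ℕ, ((Polynomial.aeval S q) ^ (m + 1)) f = 0 := by
      intro m
      rw [pow_succ, Module.End.mul_apply, hq, map_zero]
    have h3 := this (p - 1)
    rwa [Nat.sub_add_cancel (Fact.out : p.Prime).one_le] at h3
  rw [hqp, Module.algebraMap_end_apply] at h2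
  exact (smul_eq_zero.mp h2).resolve_left hs

/-- The twisted character sums are natural numbers. -/
lemma aux_mult (p : ℕ) [Fact p.Prime] (lam : Multiplicative (ZMod p) → ℂ)
    (hlam : IsCharacter (Multiplicative (ZMod p)) lam) (ψ : AddChar (ZMod p) ℂ) :
    ∃ m : ℕ, (p : ℂ)⁻¹ * ∑ x : ZMod p, lam (Multiplicative.ofAdd x) * ψ x = m := by
  obtain ⟨n, ρ, hρ⟩ := hlam
  let σ : Representation ℂ (Multiplicative (ZMod p)) (Fin n → ℂ) :=
    { toFun := fun g => ψ (Multiplicative.toAdd g) • Matrix.toLin' (ρ g : Matrix (Fin n) (Fin n) ℂ)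
      map_one' := by simp; rfl
      map_mul' := fun g h => by
        simp [AddChar.map_add_eq_mul, Matrix.toLin'_mul, smul_smul, mul_comm]
        rfl }
  have hp : (Nat.card (Multiplicative (ZMod p)) : ℂ) ≠ 0 := by simp [(Fact.out : p.Prime).ne_zero]
  have : Invertible (Nat.card (Multiplicative (ZMod p)) : ℂ) := invertibleOfNonzero hp
  have h0 := Representation.card_inv_mul_sum_char_eq_finrank σ
  refine ⟨_, Eq.trans ?_ h0⟩
  have h1 : (Nat.card (Multiplicative (ZMod p)) : ℂ) = p := by simp
  rw [h1]
  congr 1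
  rw [← Equiv.sum_comp (Multiplicative.ofAdd (α := ZMod p))]
  refine Finset.sum_congr rfl fun x _ => ?_
  simp [Representation.character, σ, hρ, mul_comm]

lemma aux_linear (p : ℕ) [Fact p.Prime] (lam : Multiplicative (ZMod p) → ℂ)
    (hlam : IsIrreducibleCharacter (Multiplicative (ZMod p)) lam) :
    ∃ ψ : AddChar (ZMod p) ℂ, ∀ x, lam (Multiplicative.ofAdd x) = ψ x := by
  classical
  obtain ⟨hc, hn⟩ := hlam
  choose m hm using aux_mult p lam hc
  have hp : (p : ℂ) ≠ 0 := by simp [(Fact.out : p.Prime).ne_zero]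
  set a : ZMod p → ℂ := fun x => lam (Multiplicative.ofAdd x) with ha
  have hn' : (p : ℂ)⁻¹ * ∑ x : ZMod p, a x * (starRingEnd ℂ) (a x) = 1 := by
    rw [← hn, charInner, ← Equiv.sum_comp (Multiplicative.ofAdd (α := ZMod p))]
    simp [a]
  have hinv : ∀ x, a x = ∑ ψ : AddChar (ZMod p) ℂ, (m ψ : ℂ) * ψ (-x) := by
    intro x
    have : ∀ ψ : AddChar (ZMod p) ℂ, (m ψ : ℂ) * ψ (-x) =
        (p : ℂ)⁻¹ * ∑ y : ZMod p, a y * ψ (y - x) := by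
      intro ψ
      rw [← hm ψ, mul_assoc, Finset.sum_mul]
      congr 1
      refine Finset.sum_congr rfl fun y _ => ?_
      rw [sub_eq_add_neg, AddChar.map_add_eq_mul, mul_assoc]
    simp_rw [this]
    rw [← Finset.mul_sum, Finset.sum_comm]
    simp_rw [← Finset.mul_sum, AddChar.sum_apply_eq_ite, sub_eq_zero]
    simp [hp]
    field_simp
  have hpar : ∑ ψ : AddChar (ZMod p) ℂ, (m ψ : ℂ) * (m ψ : ℂ) = 1 := by
    rw [← hn']
    have h1 : ∀ x, (starRingEnd ℂ) (a x) = ∑ ψ : AddChar (ZMod p) ℂ, (m ψ : ℂ) * ψ x := by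
      intro x
      rw [hinv x, map_sum]
      refine Finset.sum_congr rfl fun ψ _ => ?_
      rw [map_mul, ← AddChar.map_neg_eq_conj]
      simp
    simp_rw [h1, Finset.mul_sum]
    rw [Finset.sum_comm]
    refine Finset.sum_congr rfl fun ψ _ => ?_
    nth_rewrite 1 [← hm ψ]
    rw [Finset.mul_sum, Finset.sum_mul]
    refine Finset.sum_congr rfl fun x _ => ?_
    simp only [a]; ring
  have hpar' : ∑ ψ : AddChar (ZMod p) ℂ, m ψ * m ψ = 1 := by exact_mod_cast hpar
  obtain ⟨ψ0, -, h0⟩ : ∃ ψ ∈ Finset.univ, m ψ * m ψ ≠ 0 :=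
    Finset.exists_ne_zero_of_sum_ne_zero (by rw [hpar']; exact one_ne_zero)
  rw [← Finset.add_sum_erase _ _ (Finset.mem_univ ψ0)] at hpar'
  have hz : ∑ ψ ∈ Finset.univ.erase ψ0, m ψ * m ψ = 0 := by omega
  have h1 : m ψ0 = 1 := by
    have : m ψ0 * m ψ0 = 1 := by omega
    simpa using this
  refine ⟨ψ0⁻¹, fun x => ?_⟩
  change a x = _
  rw [hinv x, Finset.sum_eq_single ψ0, h1]
  · simp [AddChar.inv_apply]
  · intro ψ _ hne
    have := (Finset.sum_eq_zero_iff.mp hz) ψ (Finset.mem_erase.mpr ⟨hne, Finset.mem_univ _⟩)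
    have : m ψ = 0 := by simpa using this
    simp [this]
  · intro h; exact absurd (Finset.mem_univ _) h

lemma aux_inj (p : ℕ) [Fact p.Prime] (ψ : AddChar (ZMod p) ℂ) (hψ : ψ ≠ 1) (x : ZMod p)
    (hx : ψ x = 1) : x = 0 := by
  by_contra h
  apply hψ
  ext y
  have : y = (y / x).val • x := by
    rw [nsmul_eq_mul, ZMod.natCast_zmod_val]; field_simp
  rw [this, AddChar.map_nsmul_eq_pow, hx]; simp

lemma aux_tuple (p : ℕ) [Fact p.Prime] (lam : Multiplicative (ZMod p) → ℂ)
    (ψ : AddChar (ZMod p) ℂ) (hψ : ∀ x, lam (Multiplicative.ofAdd x) = ψ x)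
    (t : ZMod p → ZMod p) (f : Multiplicative (ZMod p → ZMod p)) :
    tupleChar p lam t f = ψ (∑ j, t j * Multiplicative.toAdd f j) := by
  have hsum : ∀ (s : Finset (ZMod p)) (u : ZMod p → ZMod p), ψ (∑ j ∈ s, u j) = ∏ j ∈ s, ψ (u j) := by
    classical
    intro s u
    induction s using Finset.induction_on with
    | empty => simp
    | insert a s ha ih => rw [Finset.sum_insert ha, Finset.prod_insert ha, AddChar.map_add_eq_mul, ih]
  rw [tupleChar, hsum]
  refine Finset.prod_congr rfl fun j _ => ?_
  rw [hψ, ← AddChar.map_nsmul_eq_pow, nsmul_eq_mul, ZMod.natCast_zmod_val]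

lemma aux_sum {ι : Type*} [Fintype ι] (z : ι → ℂ) (hz : ∀ i, ‖z i‖ = 1)
    (h : ∑ i, z i = ∑ _i : ι, (1 : ℂ)) (i : ι) : z i = 1 := by
  have hre : ∀ i, (z i).re ≤ 1 := fun i => (Complex.re_le_norm _).trans (hz i).le
  have h1 : ∑ i, (z i).re = ∑ _i : ι, (1 : ℝ) := by
    have := congrArg Complex.re h
    simpa using this
  have h2 := (Finset.sum_eq_sum_iff_of_le (fun i _ => hre i)).mp h1 i (Finset.mem_univ _)
  have h3 : (z i).im = 0 := by
    have := Complex.sq_norm (z i)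
    rw [hz i, Complex.normSq_apply, h2] at this
    nlinarith
  exact Complex.ext h2 h3

lemma aux_conj (p : ℕ) [Fact p.Prime] (x g : Wr p) (hg : g.right = 1) :
    Multiplicative.toAdd (x * g * x⁻¹).left =
      fun j => Multiplicative.toAdd g.left (j + Multiplicative.toAdd x.right) := by
  ext j
  simp [hg, rotHom, rotAdd]

end Helpers

/-- Suppose the exponents `i₁, …, iₚ` of `ν = λ^{i₁} × ⋯ × λ^{iₚ}` are not
all equal (so `ν^P` is irreducible). Then `ν^P` is faithful iff `i₁ + ⋯ + iₚ ≢ 0 (mod p)`. -/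
theorem induced_tupleChar_faithful_iff_sum_ne_zero
    (p : ℕ) [Fact p.Prime] (lam : Multiplicative (ZMod p) → ℂ)
    (hlam : IsIrreducibleCharacter (Multiplicative (ZMod p)) lam)
    (hlam' : lam ≠ fun _ => 1) (t : ZMod p → ZMod p)
    (ht : ¬ ∃ c : ZMod p, ∀ j : ZMod p, t j = c) :
    IsFaithfulCharacter (Wr p) (inducedFromBase p (tupleChar p lam t)) ↔
      ∑ j : ZMod p, t j ≠ 0 := by
  classical
  obtain ⟨ψ, hψ⟩ := aux_linear p lam hlam
  have hψ1 : ψ ≠ 1 := by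
    rintro rfl
    apply hlam'
    funext x
    simpa using hψ (Multiplicative.toAdd x)
  have hright : ∀ x g : Wr p, (x * g * x⁻¹).right = g.right := by
    intro x g; simp [mul_comm]
  have hval : ∀ g : Wr p, g.right = 1 → inducedFromBase p (tupleChar p lam t) g =
      (Fintype.card (Multiplicative (ZMod p → ZMod p)) : ℂ)⁻¹ *
      ∑ x : Wr p, ψ (∑ j, t j * Multiplicative.toAdd g.left (j + Multiplicative.toAdd x.right)) := by
    intro g hg
    rw [inducedFromBase]
    congr 1
    refine Finset.sum_congr rfl fun x _ => ?_
    rw [if_pos (by rw [hright, hg]), aux_tuple p lam ψ hψ, aux_conj p x g hg]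
  have hone : inducedFromBase p (tupleChar p lam t) 1 =
      (Fintype.card (Multiplicative (ZMod p → ZMod p)) : ℂ)⁻¹ * ∑ _x : Wr p, (1 : ℂ) := by
    rw [hval 1 rfl]
    simp
  have hA : (Fintype.card (Multiplicative (ZMod p → ZMod p)) : ℂ)⁻¹ ≠ 0 :=
    inv_ne_zero (Nat.cast_ne_zero.mpr Fintype.card_ne_zero)
  constructor
  · intro hF hs
    have := hF (SemidirectProduct.inl (constHom p (Multiplicative.ofAdd 1))) (by
      rw [hval _ (by simp), hone]
      congr 1
      refine Finset.sum_congr rfl fun x _ => ?_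
      simp [constHom, hs])
    rw [← map_one (SemidirectProduct.inl (φ := rotHom p)), SemidirectProduct.inl_inj] at this
    have h2 := congrFun (congrArg Multiplicative.toAdd this) 0
    exact one_ne_zero (α := ZMod p) h2
  · intro hs g hg
    by_cases hr : g.right = 1
    · rw [hval g hr, hone] at hg
      have h1 := aux_sum _ (fun x : Wr p => AddChar.norm_apply ψ _) (mul_left_cancel₀ hA hg)
      have h2 : Multiplicative.toAdd g.left = 0 := by
        refine aux_conv p t _ hs fun k => ?_
        exact aux_inj p ψ hψ1 _ (h1 (SemidirectProduct.inr (Multiplicative.ofAdd k)))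
      exact SemidirectProduct.ext h2 hr
    · exfalso
      rw [hone, inducedFromBase] at hg
      have h1 := mul_left_cancel₀ hA hg
      simp only [hright, if_neg hr] at h1
      simp only [Finset.sum_const, smul_zero, Finset.card_univ, nsmul_eq_mul, mul_one] at h1
      exact Fintype.card_ne_zero (α := Wr p) (by exact_mod_cast h1.symm)
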